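/- For all integers 1 ≤ j < g and every k with j+1 ≤ k ≤ g, one has σ ∘ ℬ^{(g)}_{2k+1} = 0 as a map B_g → B_j; that is, the Buchstaber–Shorina polynomial differential operators ℬ_{2k+1} defined for genus g with k > j become zero when restricted to the coordinate subspace ℂ^{3j} ⊂ ℂ^{3g}. -/

import Mathlib

open MvPolynomial

noncomputable section

/-- B_g = ℂ[b_{i,j} : i ∈ {1,2,3}, j odd, 1 ≤ j ≤ 2g−1], as a polynomial ring in 3g variables;
the variable (i, m) : Fin 3 × Fin g stands for b_{i+1, 2m+1}. -/
abbrev Bg (g : ℕ) : Type := MvPolynomial (Fin 3 × Fin g) ℂ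

/-- `bb g i m` is the variable b_{i, 2m−1} (zero if i ∉ {1,2,3} or m ∉ {1,…,g}). -/
noncomputable def bb (g : ℕ) (i m : ℕ) : Bg g :=
  if h : 1 ≤ i ∧ i ≤ 3 ∧ 1 ≤ m ∧ m ≤ g then
    MvPolynomial.X (⟨i - 1, by omega⟩, ⟨m - 1, by omega⟩) else 0

/-- `bv g i j` is the variable b_{i,j} for odd j (zero for j > 2g−1). -/
noncomputable def bv (g : ℕ) (i j : ℕ) : Bg g :=
  if Odd j then bb g i ((j + 1) / 2) else 0

/-- `Qg g a c` is p_{2a−1, 2c−1} for 1 ≤ a ≤ c, by the elimination recursion. -/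
noncomputable def Qg (g : ℕ) : ℕ → ℕ → Bg g
  | 0, _ => 0
  | 1, c => 2 * bb g 1 c
  | 2, c => 6 * bb g 1 1 * bb g 1 c - bb g 3 c + 6 * bb g 1 (c + 1)
  | 3, c => bb g 3 1 * bb g 1 c - bb g 2 1 * bb g 2 c + bb g 1 1 * bb g 3 c
      - 2 * (4 * bb g 1 1 ^ 2 + bb g 1 2) * bb g 1 c
      + 10 * bb g 1 1 * bb g 1 (c + 1) - 2 * bb g 3 (c + 1) + 10 * bb g 1 (c + 2)
  | (a + 4), c => 2 * (if c + 1 ≤ g then Qg g (a + 3) (c + 1) else 0)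
      - (if c + 2 ≤ g then Qg g (a + 2) (c + 2) else 0)
      - 8 * bb g 1 1 * bb g 1 (a + 2) * bb g 1 c - 2 * bb g 1 c * bb g 1 (a + 3)
      - 2 * bb g 1 (a + 2) * bb g 1 (c + 1) + bb g 1 (a + 2) * bb g 3 c
      - bb g 2 (a + 2) * bb g 2 c + bb g 3 (a + 2) * bb g 1 c

/-- `pp g k l` is p_{k,l} for odd k, l (zero if k > 2g−1 or l > 2g−1). -/
noncomputable def pp (g : ℕ) (k l : ℕ) : Bg g :=
  if Odd k ∧ Odd l ∧ k ≤ 2 * g - 1 ∧ l ≤ 2 * g - 1 then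
    if k ≤ l then Qg g ((k + 1) / 2) ((l + 1) / 2) else Qg g ((l + 1) / 2) ((k + 1) / 2)
  else 0

/-- 𝐛ᵢ(ξ) = Σ_{m=1}^{g} b_{i,2m−1} ξᵐ ∈ B_g[ξ]. -/
noncomputable def Bcoef (g i : ℕ) : Polynomial (Bg g) :=
  ∑ m ∈ Finset.Icc 1 g, Polynomial.C (bb g i m) * Polynomial.X ^ m

/-- The polynomial ξ𝐛₂(ξ)² + 2ξ𝐛₃(ξ)(1 − 𝐛₁(ξ)) + 4(1 + 2b_{1,1}ξ)(1 − 𝐛₁(ξ))². -/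
noncomputable def Fg (g : ℕ) : Polynomial (Bg g) :=
  Polynomial.X * (Bcoef g 2) ^ 2 + 2 * Polynomial.X * Bcoef g 3 * (1 - Bcoef g 1)
    + 4 * (1 + 2 * Polynomial.C (bb g 1 1) * Polynomial.X) * (1 - Bcoef g 1) ^ 2

/-- `lam g m` is λ_{2m+2}, defined by 4λ_{2m+2} = coefficient of ξ^{m+1} in `Fg g`. -/
noncomputable def lam (g m : ℕ) : Bg g := ((1 : ℂ) / 4) • ((Fg g).coeff (m + 1))

/-- The polynomial vector field D₁ on B_g:
D₁(b_{1,j}) = b_{2,j}, D₁(b_{2,j}) = b_{3,j},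
D₁(b_{3,j}) = 4(2b_{1,1}b_{2,j} + b_{2,1}b_{1,j} + b_{2,j+2}) (with b_{2,2g+1} = 0). -/
noncomputable def D1g (g : ℕ) : Derivation ℂ (Bg g) (Bg g) :=
  MvPolynomial.mkDerivation ℂ (fun v : Fin 3 × Fin g =>
    if (v.1 : ℕ) = 0 then bb g 2 ((v.2 : ℕ) + 1)
    else if (v.1 : ℕ) = 1 then bb g 3 ((v.2 : ℕ) + 1)
    else 4 * (2 * bb g 1 1 * bb g 2 ((v.2 : ℕ) + 1) + bb g 2 1 * bb g 1 ((v.2 : ℕ) + 1)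
      + bb g 2 ((v.2 : ℕ) + 2)))

/-- The polynomial vector field D_s on B_g (for odd s ≥ 3):
D_s(b_{i,j}) = (1/2)·D₁ⁱ(p_{s,j}); for s = 1 it is D₁.  (For s = 2g+1 the
conventions p_{s,j} = 0 make it the zero vector field.) -/
noncomputable def Dsg (g s : ℕ) : Derivation ℂ (Bg g) (Bg g) :=
  if s = 1 then D1g g else
  MvPolynomial.mkDerivation ℂ (fun v : Fin 3 × Fin g =>
    ((1 : ℂ) / 2) • (((D1g g).toLinearMap ^ ((v.1 : ℕ) + 1)) (pp g s (2 * (v.2 : ℕ) + 1))))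

/-- The multiplication operator by c ∈ B_g. -/
noncomputable def mulBg (g : ℕ) (c : Bg g) : Module.End ℂ (Bg g) := LinearMap.mulLeft ℂ c

/-- D_s as a ℂ-linear endomorphism of B_g. -/
noncomputable def DLg (g s : ℕ) : Module.End ℂ (Bg g) := (Dsg g s).toLinearMap

/-- ℒ = D₁² − 2b_{1,1}. -/
noncomputable def Lg (g : ℕ) : Module.End ℂ (Bg g) := DLg g 1 ^ 2 - mulBg g (2 * bb g 1 1)

/-- The Buchstaber–Shorina polynomial differential operator
ℬ_{2k+1} = D_{2k−1}D₁² − (b_{1,1}D_{2k−1} + D_{2k−1}b_{1,1})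
  − (1/2)(b_{1,2k−1}D₁ + D₁b_{1,2k−1}) − D_{2k+1}. -/
noncomputable def Bopg (g k : ℕ) : Module.End ℂ (Bg g) :=
  DLg g (2 * k - 1) * DLg g 1 ^ 2
    - (mulBg g (bb g 1 1) * DLg g (2 * k - 1) + DLg g (2 * k - 1) * mulBg g (bb g 1 1))
    - ((1 : ℂ) / 2) • (mulBg g (bv g 1 (2 * k - 1)) * DLg g 1 + DLg g 1 * mulBg g (bv g 1 (2 * k - 1)))
    - DLg g (2 * k + 1)

/-- σ : B_g → B_j, the ℂ-algebra homomorphism with σ(b_{i,l}) = b_{i,l} for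
odd l ≤ 2j−1 and σ(b_{i,l}) = 0 for odd l with 2j−1 < l ≤ 2g−1. -/
noncomputable def sg (g j : ℕ) : Bg g →ₐ[ℂ] Bg j :=
  MvPolynomial.aeval (fun v : Fin 3 × Fin g =>
    if h : (v.2 : ℕ) < j then (MvPolynomial.X (v.1, ⟨(v.2 : ℕ), h⟩) : Bg j) else 0)

theorem sg_bb {g j : ℕ} (hjg : j < g) (i m : ℕ) : sg g j (bb g i m) = bb j i m := by
  unfold bb
  by_cases h : 1 ≤ i ∧ i ≤ 3 ∧ 1 ≤ m ∧ m ≤ j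
  · rw [dif_pos h, dif_pos ⟨h.1, h.2.1, h.2.2.1, by omega⟩, sg, aeval_X, dif_pos (by simp; omega)]
  · rw [dif_neg h]
    split_ifs with h'
    · rw [sg, aeval_X, dif_neg (by simp; omega)]
    · exact map_zero _

theorem bb_eq_zero {j m : ℕ} (i : ℕ) (hm : j < m) : bb j i m = 0 :=
  dif_neg (by omega)

theorem sg_D1g {g j : ℕ} (hjg : j < g) (f : Bg g) :
    sg g j (D1g g f) = D1g j (sg g j f) := by
  induction f using MvPolynomial.induction_on with
  | C a => simp [← algebraMap_eq]
  | add p q hp hq => simp only [map_add, hp, hq]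
  | mul_X p v hp =>
    have hX : sg g j (D1g g (X v)) = D1g j (sg g j (X v)) := by
      by_cases hv : (v.2 : ℕ) < j
      · rw [sg, aeval_X, dif_pos hv, ← sg, D1g, D1g, mkDerivation_X, mkDerivation_X]
        split_ifs <;> simp [sg_bb hjg, map_ofNat, *]
      · rw [D1g, mkDerivation_X, sg, aeval_X, dif_neg hv, ← sg, map_zero]
        split_ifs <;>
          simp [sg_bb hjg, bb_eq_zero _ (show j < (v.2 : ℕ) + 1 by omega),
            bb_eq_zero _ (show j < (v.2 : ℕ) + 2 by omega)]
    simp only [Derivation.leibniz, map_add, smul_eq_mul, map_mul, hp, hX]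

theorem sg_Qg_eq_zero {g j : ℕ} (hjg : j < g) :
    ∀ a c : ℕ, j < c → sg g j (Qg g a c) = 0
  | 0, c, _ => by simp [Qg]
  | 1, c, hc => by simp [Qg, sg_bb hjg, bb_eq_zero _ hc]
  | 2, c, hc => by
    simp [Qg, sg_bb hjg, bb_eq_zero _ hc, bb_eq_zero _ (show j < c + 1 by omega)]
  | 3, c, hc => by
    simp [Qg, sg_bb hjg, bb_eq_zero _ hc, bb_eq_zero _ (show j < c + 1 by omega),
      bb_eq_zero _ (show j < c + 2 by omega)]
  | a + 4, c, hc => by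
    have h₁ := sg_Qg_eq_zero hjg (a + 3) (c + 1) (by omega)
    have h₂ := sg_Qg_eq_zero hjg (a + 2) (c + 2) (by omega)
    simp [Qg, apply_ite (sg g j), h₁, h₂, sg_bb hjg, bb_eq_zero _ hc,
      bb_eq_zero _ (show j < c + 1 by omega)]

theorem sg_pp_eq_zero {g j k : ℕ} (hjg : j < g) (hk : j < (k + 1) / 2) (l : ℕ) :
    sg g j (pp g k l) = 0 := by
  unfold pp
  split_ifs
  · exact sg_Qg_eq_zero hjg _ _ (by omega)
  · exact sg_Qg_eq_zero hjg _ _ hk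
  · exact map_zero _

theorem sg_D1g_pow_eq_zero {g j : ℕ} (hjg : j < g) {f : Bg g} (hf : sg g j f = 0) (n : ℕ) :
    sg g j (((D1g g).toLinearMap ^ n) f) = 0 := by
  induction n with
  | zero => simpa using hf
  | succ n ih =>
    rw [pow_succ', Module.End.mul_apply]
    exact (sg_D1g hjg _).trans (by rw [ih, map_zero])

theorem sg_Dsg_eq_zero {g j s : ℕ} (hj : 1 ≤ j) (hjg : j < g) (hs : j < (s + 1) / 2)
    (f : Bg g) : sg g j (Dsg g s f) = 0 := by
  induction f using MvPolynomial.induction_on with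
  | C a => simp [← algebraMap_eq]
  | add p q hp hq => simp only [map_add, hp, hq, add_zero]
  | mul_X p v hp =>
    have hX : sg g j (Dsg g s (X v)) = 0 := by
      rw [Dsg, if_neg (by omega), mkDerivation_X, map_smul,
        sg_D1g_pow_eq_zero hjg (sg_pp_eq_zero hjg hs _), smul_zero]
    simp only [Derivation.leibniz, map_add, smul_eq_mul, map_mul, hp, hX, mul_zero, add_zero]

/-- for 1 ≤ j < g and j+1 ≤ k ≤ g, σ ∘ ℬ^{(g)}_{2k+1} = 0. -/
theorem stmt12 (g j : ℕ) (hj : 1 ≤ j) (hjg : j < g) :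
    ∀ k, j + 1 ≤ k → k ≤ g → ∀ f : Bg g, sg g j (Bopg g k f) = 0 := by
  intro k hk _ f
  have hb : sg g j (bv g 1 (2 * k - 1)) = 0 := by
    rw [bv, if_pos ⟨k - 1, by omega⟩, sg_bb hjg, bb_eq_zero _ (by omega)]
  have hD (f : Bg g) : sg g j (Dsg g (2 * k - 1) f) = 0 :=
    sg_Dsg_eq_zero hj hjg (by omega) f
  have hD' (f : Bg g) : sg g j (Dsg g (2 * k + 1) f) = 0 :=
    sg_Dsg_eq_zero hj hjg (by omega) f
  have hD₁ (f : Bg g) : sg g j (Dsg g 1 f) = D1g j (sg g j f) := by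
    rw [Dsg, if_pos rfl, sg_D1g hjg]
  simp [Bopg, DLg, mulBg, hb, hD, hD', hD₁, -Derivation.leibniz]

end
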